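/- For every real number s, the function x ↦ [ψ'(x+s)]² + ψ''(x+s) is completely monotonic on the interval (−s, ∞). In particular, [ψ'(x)]² + ψ''(x) > 0 for all x > 0. -/

import Mathlib

/-- The digamma function `ψ = Γ'/Γ`, as the derivative of `log ∘ Γ`. -/
noncomputable def digamma (x : ℝ) : ℝ := deriv (fun y : ℝ => Real.log (Real.Gamma y)) x

/-- The trigamma function `ψ'`. -/
noncomputable def trigamma (x : ℝ) : ℝ := deriv digamma x

/-- The tetragamma function `ψ''`. -/
noncomputable def tetragamma (x : ℝ) : ℝ := deriv trigamma x

open Filter Topology Set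
open scoped ContDiff

/-- Complete monotonicity on the positive half-line. -/
structure IsCompletelyMonotone (f : ℝ → ℝ) : Prop where
  contDiffOn : ContDiffOn ℝ ∞ f (Ioi 0)
  nonneg : ∀ (n : ℕ) (x : ℝ), 0 < x → 0 ≤ (-1 : ℝ) ^ n * iteratedDeriv n f x

/-- A smooth function on the positive half-line all of whose derivatives tend to zero along
every sequence `x, x + 1, x + 2, …`. -/
structure HasVanishingDerivs (f : ℝ → ℝ) : Prop where
  contDiffOn : ContDiffOn ℝ ∞ f (Ioi 0)
  tendsto : ∀ (n : ℕ) (x : ℝ), 0 < x →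
    Tendsto (fun N : ℕ => iteratedDeriv n f (x + N)) atTop (𝓝 0)

theorem ContDiffOn.contDiffAt_of_pos {f : ℝ → ℝ} (hf : ContDiffOn ℝ ∞ f (Ioi 0)) (n : ℕ)
    {x : ℝ} (hx : 0 < x) : ContDiffAt ℝ n f x :=
  (hf.contDiffAt (Ioi_mem_nhds hx)).of_le (by exact_mod_cast le_top)

theorem iteratedDeriv_congr_of_eqOn_pos {f g : ℝ → ℝ} (h : ∀ x, 0 < x → f x = g x) (n : ℕ)
    {x : ℝ} (hx : 0 < x) : iteratedDeriv n f x = iteratedDeriv n g x :=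
  EventuallyEq.iteratedDeriv_eq n (eventually_of_mem (Ioi_mem_nhds hx) h)

namespace IsCompletelyMonotone

variable {f g : ℝ → ℝ}

theorem mul (hf : IsCompletelyMonotone f) (hg : IsCompletelyMonotone g) :
    IsCompletelyMonotone (fun x => f x * g x) where
  contDiffOn := hf.contDiffOn.mul hg.contDiffOn
  nonneg n x hx := by
    rw [iteratedDeriv_fun_mul (hf.contDiffOn.contDiffAt_of_pos n hx)
      (hg.contDiffOn.contDiffAt_of_pos n hx), Finset.mul_sum]
    refine Finset.sum_nonneg fun i hi => ?_
    have hin : i + (n - i) = n := by have := Finset.mem_range.1 hi; omega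
    have h := mul_nonneg (mul_nonneg (hf.nonneg i x hx) (hg.nonneg (n - i) x hx))
      (Nat.cast_nonneg (α := ℝ) (n.choose i))
    have hsign : (-1 : ℝ) ^ n = (-1) ^ i * (-1) ^ (n - i) := by rw [← pow_add, hin]
    rw [hsign]
    linarith

theorem const_mul {c : ℝ} (hc : 0 ≤ c) (hf : IsCompletelyMonotone f) :
    IsCompletelyMonotone (fun x => c * f x) where
  contDiffOn := contDiffOn_const.mul hf.contDiffOn
  nonneg n x hx := by
    rw [iteratedDeriv_const_mul_field, mul_left_comm]
    exact mul_nonneg hc (hf.nonneg n x hx)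

theorem comp_add_one (hf : IsCompletelyMonotone f) :
    IsCompletelyMonotone (fun x => f (x + 1)) where
  contDiffOn := hf.contDiffOn.comp (by fun_prop) fun x (hx : 0 < x) => mem_Ioi.2 (by positivity)
  nonneg n x hx := by
    rw [iteratedDeriv_comp_add_const]
    exact hf.nonneg n (x + 1) (by positivity)

end IsCompletelyMonotone

namespace HasVanishingDerivs

variable {f g : ℝ → ℝ}

theorem add (hf : HasVanishingDerivs f) (hg : HasVanishingDerivs g) :
    HasVanishingDerivs (fun x => f x + g x) where
  contDiffOn := hf.contDiffOn.add hg.contDiffOn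
  tendsto n x hx := by
    have h := (hf.tendsto n x hx).add (hg.tendsto n x hx)
    rw [add_zero] at h
    refine h.congr fun N => ?_
    have hN : 0 < x + N := by positivity
    rw [iteratedDeriv_fun_add (hf.contDiffOn.contDiffAt_of_pos n hN)
      (hg.contDiffOn.contDiffAt_of_pos n hN)]

theorem mul (hf : HasVanishingDerivs f) (hg : HasVanishingDerivs g) :
    HasVanishingDerivs (fun x => f x * g x) where
  contDiffOn := hf.contDiffOn.mul hg.contDiffOn
  tendsto n x hx := by
    have h : Tendsto (fun N : ℕ => ∑ i ∈ Finset.range (n + 1), (n.choose i : ℝ) *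
        iteratedDeriv i f (x + N) * iteratedDeriv (n - i) g (x + N)) atTop
        (𝓝 (∑ i ∈ Finset.range (n + 1), (n.choose i : ℝ) * 0 * 0)) :=
      tendsto_finsetSum _ fun i _ =>
        ((hf.tendsto i x hx).const_mul _).mul (hg.tendsto (n - i) x hx)
    simp only [mul_zero, Finset.sum_const_zero] at h
    refine h.congr fun N => ?_
    have hN : 0 < x + N := by positivity
    rw [iteratedDeriv_fun_mul (hf.contDiffOn.contDiffAt_of_pos n hN)
      (hg.contDiffOn.contDiffAt_of_pos n hN)]

theorem const_mul (c : ℝ) (hf : HasVanishingDerivs f) :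
    HasVanishingDerivs (fun x => c * f x) where
  contDiffOn := contDiffOn_const.mul hf.contDiffOn
  tendsto n x hx := by
    simp only [iteratedDeriv_const_mul_field]
    simpa using (hf.tendsto n x hx).const_mul c

theorem isCompletelyMonotone_of_sub (hf : HasVanishingDerivs f) (hg : IsCompletelyMonotone g)
    (h : ∀ x, 0 < x → f x - f (x + 1) = g x) : IsCompletelyMonotone f where
  contDiffOn := hf.contDiffOn
  nonneg n x hx := by
    have key : ∀ y, 0 < y →
        iteratedDeriv n f y - iteratedDeriv n f (y + 1) = iteratedDeriv n g y := by
      intro y hy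
      have hshift : ContDiffAt ℝ n (fun z => f (z + 1)) y :=
        ContDiffAt.comp y (hf.contDiffOn.contDiffAt_of_pos n (by positivity)) (by fun_prop)
      rw [← iteratedDeriv_congr_of_eqOn_pos h n hy,
        iteratedDeriv_fun_sub (hf.contDiffOn.contDiffAt_of_pos n hy) hshift,
        iteratedDeriv_comp_add_const]
    have hanti : Antitone fun N : ℕ => (-1 : ℝ) ^ n * iteratedDeriv n f (x + N) := by
      refine antitone_nat_of_succ_le fun N => ?_
      have hN : 0 < x + N := by positivity
      have := hg.nonneg n _ hN
      rw [← key _ hN, mul_sub] at this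
      push_cast
      rw [← add_assoc]
      linarith
    have hlim := (hf.tendsto n x hx).const_mul ((-1 : ℝ) ^ n)
    rw [mul_zero] at hlim
    simpa using hanti.le_of_tendsto hlim 0

end HasVanishingDerivs

theorem iteratedDeriv_inv_eq (n : ℕ) (x : ℝ) :
    iteratedDeriv n (fun y : ℝ => y⁻¹) x = (-1) ^ n * (n.factorial * (x⁻¹) ^ (n + 1)) := by
  have h := iter_deriv_inv n x
  rw [iteratedDeriv_eq_iterate]
  refine h.trans ?_
  rw [mul_assoc, show (-1 - (n : ℤ)) = -((n + 1 : ℕ) : ℤ) by push_cast; ring, zpow_neg,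
    zpow_natCast, inv_pow]

theorem contDiffOn_inv_pos : ContDiffOn ℝ ∞ (fun y : ℝ => y⁻¹) (Ioi 0) :=
  fun _ hx => (contDiffAt_inv ℝ (ne_of_gt hx)).contDiffWithinAt

theorem isCompletelyMonotone_inv : IsCompletelyMonotone (fun x => x⁻¹) where
  contDiffOn := contDiffOn_inv_pos
  nonneg n x hx := by
    rw [iteratedDeriv_inv_eq, ← mul_assoc, ← mul_pow]
    norm_num
    positivity

theorem hasVanishingDerivs_inv : HasVanishingDerivs (fun x => x⁻¹) where
  contDiffOn := contDiffOn_inv_pos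
  tendsto n x _hx := by
    simp only [iteratedDeriv_inv_eq]
    have h : Tendsto (fun N : ℕ => (x + N)⁻¹) atTop (𝓝 0) :=
      tendsto_inv_atTop_zero.comp (tendsto_atTop_add_const_left _ x tendsto_natCast_atTop_atTop)
    simpa using ((h.pow (n + 1)).const_mul (n.factorial : ℝ)).const_mul ((-1 : ℝ) ^ n)

/-- The series `∑ k, 1 / (x + k) ^ m`, the Hurwitz zeta function at the integer `m`. -/
noncomputable def hurwitzSum (m : ℕ) (x : ℝ) : ℝ := ∑' k : ℕ, ((x + k) ^ m)⁻¹

theorem summable_inv_add_nat_pow {m : ℕ} (hm : 2 ≤ m) {x : ℝ} (hx : 0 < x) :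
    Summable fun k : ℕ => ((x + k) ^ m)⁻¹ := by
  have h := (Real.summable_one_div_nat_add_rpow x m).2 (by exact_mod_cast hm)
  refine h.congr fun k => ?_
  rw [abs_of_pos (by positivity), Real.rpow_natCast, one_div, add_comm]

theorem hurwitzSum_eq_add {m : ℕ} (hm : 2 ≤ m) {x : ℝ} (hx : 0 < x) :
    hurwitzSum m x = (x ^ m)⁻¹ + hurwitzSum m (x + 1) := by
  rw [hurwitzSum, (summable_inv_add_nat_pow hm hx).tsum_eq_zero_add, hurwitzSum]
  simp only [Nat.cast_zero, add_zero, Nat.cast_add, Nat.cast_one]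
  congr 2
  ext k
  ring_nf

theorem tendsto_hurwitzSum_add_nat (m : ℕ) (x : ℝ) :
    Tendsto (fun N : ℕ => hurwitzSum m (x + N)) atTop (𝓝 0) := by
  refine (tendsto_sum_nat_add fun k : ℕ => ((x + k) ^ m)⁻¹).congr fun N => ?_
  rw [hurwitzSum]
  congr 1
  ext k
  push_cast
  ring_nf

theorem hasDerivAt_inv_add_nat_pow (m k : ℕ) {y : ℝ} (hy : 0 < y) :
    HasDerivAt (fun z : ℝ => ((z + k) ^ m)⁻¹) (-m * ((y + k) ^ (m + 1))⁻¹) y := by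
  have hne : y + k ≠ 0 := by positivity
  have h := (((hasDerivAt_id y).add_const (k : ℝ)).pow m).inv (pow_ne_zero m hne)
  refine h.congr_deriv ?_
  rcases m with _ | m
  · simp
  · simp only [id_eq, Nat.add_sub_cancel, Pi.pow_apply]
    field_simp
    ring

theorem hasDerivAt_hurwitzSum {m : ℕ} (hm : 2 ≤ m) {x : ℝ} (hx : 0 < x) :
    HasDerivAt (hurwitzSum m) (-m * hurwitzSum (m + 1) x) x := by
  have hx2 : 0 < x / 2 := by positivity
  have hmem : x ∈ Ioi (x / 2) := half_lt_self hx
  unfold hurwitzSum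
  rw [← tsum_mul_left]
  refine hasDerivAt_tsum_of_isPreconnected
    (u := fun k : ℕ => (m : ℝ) * ((x / 2 + k) ^ (m + 1))⁻¹)
    ((summable_inv_add_nat_pow (by omega) hx2).mul_left _) isOpen_Ioi isPreconnected_Ioi
    (fun k y hy => hasDerivAt_inv_add_nat_pow m k (hx2.trans hy)) (fun k y hy => ?_) hmem
    (summable_inv_add_nat_pow hm hx) hmem
  have hy0 : 0 < y := hx2.trans hy
  have hle : x / 2 ≤ y := le_of_lt hy
  rw [norm_mul, norm_neg, Real.norm_of_nonneg (by positivity), Real.norm_of_nonneg (by positivity)]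
  gcongr

theorem contDiffOn_hurwitzSum {m : ℕ} (hm : 2 ≤ m) : ContDiffOn ℝ ∞ (hurwitzSum m) (Ioi 0) := by
  refine contDiffOn_infty.2 fun n => ?_
  induction n generalizing m with
  | zero =>
    exact contDiffOn_zero.2 fun x hx => (hasDerivAt_hurwitzSum hm hx).continuousAt.continuousWithinAt
  | succ n ih =>
    push_cast
    rw [contDiffOn_succ_iff_deriv_of_isOpen isOpen_Ioi]
    refine ⟨fun x hx => (hasDerivAt_hurwitzSum hm hx).differentiableAt.differentiableWithinAt,
      by simp, ?_⟩
    exact ((contDiffOn_const (c := -(m : ℝ))).mul (ih (m := m + 1) (by omega))).congr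
      fun x hx => (hasDerivAt_hurwitzSum hm hx).deriv

theorem exists_iteratedDeriv_hurwitzSum (n : ℕ) {m : ℕ} (hm : 2 ≤ m) :
    ∃ c : ℝ, ∀ x, 0 < x → iteratedDeriv n (hurwitzSum m) x = c * hurwitzSum (m + n) x := by
  induction n with
  | zero => exact ⟨1, fun x _ => by simp⟩
  | succ n ih =>
    obtain ⟨c, hc⟩ := ih
    refine ⟨c * (-(m + n : ℕ)), fun x hx => ?_⟩
    have h : iteratedDeriv n (hurwitzSum m) =ᶠ[𝓝 x] fun y => c * hurwitzSum (m + n) y :=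
      eventually_of_mem (Ioi_mem_nhds hx) hc
    rw [iteratedDeriv_succ, h.deriv_eq,
      ((hasDerivAt_hurwitzSum (by omega : 2 ≤ m + n) hx).const_mul c).deriv]
    rw [add_assoc, mul_assoc]

theorem hasVanishingDerivs_hurwitzSum {m : ℕ} (hm : 2 ≤ m) :
    HasVanishingDerivs (hurwitzSum m) where
  contDiffOn := contDiffOn_hurwitzSum hm
  tendsto n x hx := by
    obtain ⟨c, hc⟩ := exists_iteratedDeriv_hurwitzSum n hm
    have h := (tendsto_hurwitzSum_add_nat (m + n) x).const_mul c
    rw [mul_zero] at h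
    exact h.congr fun N => (hc _ (by positivity)).symm

/-- The series `∑ k, (1 / (k + 1) - 1 / (x + k))`, which is the digamma function up to an additive
constant. -/
noncomputable def digammaSeries (x : ℝ) : ℝ := ∑' k : ℕ, ((1 + (k : ℝ))⁻¹ - (x + k)⁻¹)

theorem summable_inv_sub_inv {x y : ℝ} (hx : 0 < x) (hy : 0 < y) :
    Summable fun k : ℕ => (x + k : ℝ)⁻¹ - (y + k)⁻¹ := by
  have hm : 0 < min x y := lt_min hx hy
  refine .of_norm_bounded
    ((summable_inv_add_nat_pow le_rfl hm).mul_left |y - x|) fun k => ?_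
  have h1 : 0 < x + k := by positivity
  have h2 : 0 < y + k := by positivity
  have h3 : min x y + k ≤ x + k := by gcongr; exact min_le_left _ _
  have h4 : min x y + k ≤ y + k := by gcongr; exact min_le_right _ _
  rw [inv_sub_inv h1.ne' h2.ne', Real.norm_eq_abs, abs_div, abs_of_pos (mul_pos h1 h2),
    div_eq_mul_inv, add_sub_add_right_eq_sub, sq]
  gcongr

theorem digammaSeries_sub {x y : ℝ} (hx : 0 < x) (hy : 0 < y) :
    digammaSeries y - digammaSeries x = ∑' k : ℕ, ((x + k : ℝ)⁻¹ - (y + k)⁻¹) := by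
  rw [digammaSeries, digammaSeries, ← (summable_inv_sub_inv one_pos hy).tsum_sub
    (summable_inv_sub_inv one_pos hx)]
  congr 1
  ext k
  ring

theorem tendsto_digammaSeries_sub {x y : ℝ} (hx : 0 < x) (hy : 0 < y) :
    Tendsto (fun N : ℕ => digammaSeries (y + N) - digammaSeries (x + N)) atTop (𝓝 0) := by
  refine (tendsto_sum_nat_add fun k : ℕ => (x + k : ℝ)⁻¹ - (y + k)⁻¹).congr fun N => ?_
  rw [digammaSeries_sub (by positivity) (by positivity)]
  congr 1
  ext k
  push_cast
  ring_nf

theorem digammaSeries_add_one {x : ℝ} (hx : 0 < x) :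
    digammaSeries (x + 1) = digammaSeries x + x⁻¹ := by
  have hx1 : 0 < x + 1 := by positivity
  rw [← sub_eq_iff_eq_add', digammaSeries_sub hx hx1]
  refine ((summable_inv_sub_inv hx hx1).hasSum_iff_tendsto_nat.2 ?_).tsum_eq
  have h : Tendsto (fun N : ℕ => x⁻¹ - (x + N)⁻¹) atTop (𝓝 (x⁻¹ - 0)) :=
    (tendsto_inv_atTop_zero.comp
      (tendsto_atTop_add_const_left _ x tendsto_natCast_atTop_atTop)).const_sub _
  rw [sub_zero] at h
  refine h.congr fun N => ?_
  have := Finset.sum_range_sub' (fun k : ℕ => (x + k : ℝ)⁻¹) N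
  simp only [Nat.cast_zero, add_zero] at this
  rw [← this]
  refine Finset.sum_congr rfl fun k _ => ?_
  push_cast
  ring_nf

theorem hasDerivAt_digammaSeries {x : ℝ} (hx : 0 < x) :
    HasDerivAt digammaSeries (hurwitzSum 2 x) x := by
  have hx2 : 0 < x / 2 := by positivity
  have hmem : x ∈ Ioi (x / 2) := half_lt_self hx
  have hterm (k : ℕ) (y : ℝ) (hy : y ∈ Ioi (x / 2)) :
      HasDerivAt (fun z : ℝ => (1 + (k : ℝ))⁻¹ - (z + k)⁻¹) (((y + k) ^ 2)⁻¹) y := by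
    have h := (hasDerivAt_inv_add_nat_pow 1 k (hx2.trans hy)).const_sub (1 + (k : ℝ))⁻¹
    simp only [pow_one, Nat.cast_one, one_add_one_eq_two, neg_mul, one_mul, neg_neg] at h
    exact h
  have hbound (k : ℕ) (y : ℝ) (hy : y ∈ Ioi (x / 2)) :
      ‖((y + k) ^ 2)⁻¹‖ ≤ ((x / 2 + k) ^ 2)⁻¹ := by
    have hy0 : 0 < y := hx2.trans hy
    have hle : x / 2 ≤ y := le_of_lt hy
    rw [Real.norm_of_nonneg (by positivity)]
    gcongr
  exact hasDerivAt_tsum_of_isPreconnected (summable_inv_add_nat_pow le_rfl hx2) isOpen_Ioi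
    isPreconnected_Ioi hterm hbound hmem (summable_inv_sub_inv one_pos hx) hmem

theorem differentiableAt_log_Gamma {x : ℝ} (hx : 0 < x) :
    DifferentiableAt ℝ (fun y : ℝ => Real.log (Real.Gamma y)) x := by
  refine (Real.differentiableAt_Gamma fun m => ?_).log (Real.Gamma_pos_of_pos hx).ne'
  have : (0 : ℝ) ≤ m := m.cast_nonneg
  linarith

theorem monotoneOn_digamma : MonotoneOn digamma (Ioi 0) :=
  Real.convexOn_log_Gamma.monotoneOn_deriv fun _ hx => differentiableAt_log_Gamma hx

theorem digamma_add_one {x : ℝ} (hx : 0 < x) : digamma (x + 1) = digamma x + x⁻¹ := by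
  have h : (fun y : ℝ => Real.log (Real.Gamma (y + 1))) =ᶠ[𝓝 x]
      fun y => Real.log (Real.Gamma y) + Real.log y := by
    filter_upwards [Ioi_mem_nhds hx] with y hy
    rw [Real.Gamma_add_one (ne_of_gt hy), Real.log_mul (ne_of_gt hy)
      (Real.Gamma_pos_of_pos hy).ne', add_comm]
  have h' := h.deriv_eq
  rw [deriv_comp_add_const (f := fun y : ℝ => Real.log (Real.Gamma y)),
    deriv_fun_add (differentiableAt_log_Gamma hx) (Real.differentiableAt_log hx.ne'),
    Real.deriv_log] at h'
  exact h'

theorem digamma_sub_digammaSeries_add_nat {x : ℝ} (hx : 0 < x) (N : ℕ) :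
    digamma (x + N) - digammaSeries (x + N) = digamma x - digammaSeries x := by
  induction N with
  | zero => simp
  | succ N ih =>
    have hN : 0 < x + N := by positivity
    push_cast
    rw [← add_assoc, digamma_add_one hN, digammaSeries_add_one hN, ← ih]
    ring

theorem digamma_sub_digammaSeries_mono {x y : ℝ} (hx : 0 < x) (hxy : x ≤ y) :
    digamma x - digammaSeries x ≤ digamma y - digammaSeries y := by
  have hy : 0 < y := hx.trans_le hxy
  refine le_of_sub_nonneg (le_of_tendsto' (tendsto_digammaSeries_sub hy hx) fun N => ?_)
  rw [← digamma_sub_digammaSeries_add_nat hx N, ← digamma_sub_digammaSeries_add_nat hy N]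
  have h : digamma (x + N) ≤ digamma (y + N) :=
    monotoneOn_digamma (mem_Ioi.2 (by positivity)) (mem_Ioi.2 (by positivity)) (by gcongr)
  linarith

theorem digamma_sub_digammaSeries_eq {x y : ℝ} (hx : 0 < x) (hxy : x ≤ y) :
    digamma x - digammaSeries x = digamma y - digammaSeries y := by
  refine le_antisymm (digamma_sub_digammaSeries_mono hx hxy) ?_
  obtain ⟨N, hN⟩ := exists_nat_ge (y - x)
  rw [← digamma_sub_digammaSeries_add_nat hx N]
  exact digamma_sub_digammaSeries_mono (hx.trans_le hxy) (by linarith)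

theorem trigamma_eq_hurwitzSum {x : ℝ} (hx : 0 < x) : trigamma x = hurwitzSum 2 x := by
  have h : digamma =ᶠ[𝓝 x] fun y => digammaSeries y + (digamma x - digammaSeries x) := by
    filter_upwards [Ioi_mem_nhds hx] with y hy
    rcases le_total x y with hxy | hxy
    · linarith [digamma_sub_digammaSeries_eq hx hxy]
    · linarith [digamma_sub_digammaSeries_eq hy hxy]
  rw [trigamma, h.deriv_eq]
  exact ((hasDerivAt_digammaSeries hx).add_const _).deriv

theorem tetragamma_eq_hurwitzSum {x : ℝ} (hx : 0 < x) : tetragamma x = -2 * hurwitzSum 3 x := by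
  have h : trigamma =ᶠ[𝓝 x] hurwitzSum 2 :=
    eventually_of_mem (Ioi_mem_nhds hx) fun _ hy => trigamma_eq_hurwitzSum hy
  rw [tetragamma, h.deriv_eq, (hasDerivAt_hurwitzSum le_rfl hx).deriv]
  norm_num

/-- The remainder `ψ'(x) - 1 / x - 1 / (2 x ^ 2)`. -/
noncomputable def trigammaRemainder (x : ℝ) : ℝ :=
  hurwitzSum 2 x + ((-1) * x⁻¹ + (-1 / 2) * (x⁻¹ * x⁻¹))

theorem trigammaRemainder_sub {x : ℝ} (hx : 0 < x) :
    trigammaRemainder x - trigammaRemainder (x + 1) =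
      1 / 2 * ((x⁻¹ * (x + 1)⁻¹) * (x⁻¹ * (x + 1)⁻¹)) := by
  have hx1 : x + 1 ≠ 0 := by positivity
  rw [trigammaRemainder, trigammaRemainder, hurwitzSum_eq_add le_rfl hx]
  field_simp
  ring

theorem isCompletelyMonotone_trigammaRemainder : IsCompletelyMonotone trigammaRemainder := by
  have hV : HasVanishingDerivs trigammaRemainder :=
    (hasVanishingDerivs_hurwitzSum le_rfl).add ((hasVanishingDerivs_inv.const_mul _).add
      ((hasVanishingDerivs_inv.mul hasVanishingDerivs_inv).const_mul _))
  have hI := isCompletelyMonotone_inv.mul isCompletelyMonotone_inv.comp_add_one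
  exact hV.isCompletelyMonotone_of_sub ((hI.mul hI).const_mul (by norm_num))
    fun _ hx => trigammaRemainder_sub hx

theorem trigammaRemainder_pos {x : ℝ} (hx : 0 < x) : 0 < trigammaRemainder x := by
  have hx1 : 0 < x + 1 := by positivity
  have h := isCompletelyMonotone_trigammaRemainder.nonneg 0 (x + 1) hx1
  simp only [pow_zero, iteratedDeriv_zero, one_mul] at h
  have hd : 0 < trigammaRemainder x - trigammaRemainder (x + 1) := by
    rw [trigammaRemainder_sub hx]
    positivity
  linarith

theorem trigamma_sq_add_tetragamma_eq {x : ℝ} (hx : 0 < x) :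
    trigamma x ^ 2 + tetragamma x = hurwitzSum 2 x * hurwitzSum 2 x + -2 * hurwitzSum 3 x := by
  rw [trigamma_eq_hurwitzSum hx, tetragamma_eq_hurwitzSum hx, sq]

theorem trigamma_sq_add_tetragamma_sub {x : ℝ} (hx : 0 < x) :
    (hurwitzSum 2 x * hurwitzSum 2 x + -2 * hurwitzSum 3 x) -
      (hurwitzSum 2 (x + 1) * hurwitzSum 2 (x + 1) + -2 * hurwitzSum 3 (x + 1)) =
      2 * ((x⁻¹ * x⁻¹) * trigammaRemainder x) := by
  rw [trigammaRemainder, hurwitzSum_eq_add le_rfl hx, hurwitzSum_eq_add (by norm_num) hx]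
  field_simp
  ring

theorem isCompletelyMonotone_hurwitzSum_sq_sub :
    IsCompletelyMonotone fun x => hurwitzSum 2 x * hurwitzSum 2 x + -2 * hurwitzSum 3 x := by
  have h2 := hasVanishingDerivs_hurwitzSum (le_refl 2)
  have h3 := hasVanishingDerivs_hurwitzSum (m := 3) (by norm_num)
  exact ((h2.mul h2).add (h3.const_mul _)).isCompletelyMonotone_of_sub
    (((isCompletelyMonotone_inv.mul isCompletelyMonotone_inv).mul
      isCompletelyMonotone_trigammaRemainder).const_mul zero_le_two)
    fun _ hx => trigamma_sq_add_tetragamma_sub hx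

/-- For every real `s`, the function `x ↦ [ψ'(x+s)]² + ψ''(x+s)` is completely monotonic
on `(−s, ∞)`; in particular `[ψ'(x)]² + ψ''(x) > 0` for all `x > 0`. -/
theorem trigamma_sq_add_tetragamma_completely_monotonic (s : ℝ) :
    (∀ n : ℕ, ∀ x ∈ Set.Ioi (-s),
      0 ≤ (-1 : ℝ) ^ n *
        iteratedDeriv n (fun y : ℝ => (trigamma (y + s)) ^ 2 + tetragamma (y + s)) x) ∧
    (∀ x : ℝ, 0 < x → 0 < (trigamma x) ^ 2 + tetragamma x) := by
  refine ⟨fun n x hx => ?_, fun x hx => ?_⟩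
  · have hxs : 0 < x + s := neg_lt_iff_pos_add.1 hx
    rw [iteratedDeriv_comp_add_const n (fun y => trigamma y ^ 2 + tetragamma y) s]
    beta_reduce
    rw [iteratedDeriv_congr_of_eqOn_pos (fun _ hy => trigamma_sq_add_tetragamma_eq hy) n hxs]
    exact isCompletelyMonotone_hurwitzSum_sq_sub.nonneg n _ hxs
  · have h := isCompletelyMonotone_hurwitzSum_sq_sub.nonneg 0 (x + 1) (by positivity)
    simp only [pow_zero, iteratedDeriv_zero, one_mul] at h
    have hpos : 0 < 2 * ((x⁻¹ * x⁻¹) * trigammaRemainder x) := by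
      have := trigammaRemainder_pos hx
      positivity
    rw [← trigamma_sq_add_tetragamma_sub hx] at hpos
    rw [trigamma_sq_add_tetragamma_eq hx]
    linarith
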